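/- Let F(z) = Σ_{j∈J} c(j) z^j be a nonzero Laurent polynomial in k variables with complex coefficients, and let j₀ be an extreme point (vertex) of the convex hull in ℝ^k of the exponents j with c(j) ≠ 0. Then m(F) ≥ log|c(j₀)|. In particular, if F has integer coefficients, then m(F) ≥ 0. -/

import Mathlib

open MeasureTheory

noncomputable section

/-- A Laurent polynomial in `k` variables, given by its finitely supported
coefficient function on exponent vectors in `ℤ^k`. -/
abbrev LPoly (k : ℕ) := (Fin k → ℤ) →₀ ℂ

/-- Evaluation of a Laurent polynomial at a point of `ℂ^k`. -/
def evalT {k : ℕ} (F : LPoly k) (z : Fin k → ℂ) : ℂ :=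
  ∑ e ∈ F.support, F e * ∏ i, z i ^ (e i)

/-- The point of the `k`-torus with angles `t`. -/
def torusPt {k : ℕ} (t : Fin k → ℝ) : Fin k → ℂ :=
  fun i => Complex.exp (2 * Real.pi * Complex.I * (t i))

/-- The logarithmic Mahler measure of a Laurent polynomial in `k` variables. -/
def mm {k : ℕ} (F : LPoly k) : ℝ :=
  ∫ t in Set.Icc (0 : Fin k → ℝ) 1, Real.log ‖evalT F (torusPt t)‖

/-- The exponent substitution attached to an integer matrix `A ∈ ℤ^{ℓ×k}`. -/
def substExp {l k : ℕ} (A : Matrix (Fin l) (Fin k) ℤ) (e : Fin k → ℤ) : Fin l → ℤ :=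
  fun i => ∑ j, A i j * e j

/-- `substM A F` is the Laurent polynomial `F_A(z) = F(z^A)` in `ℓ` variables. -/
def substM {l k : ℕ} (A : Matrix (Fin l) (Fin k) ℤ) (F : LPoly k) : LPoly l :=
  Finsupp.mapDomain (substExp A) F

/-- A one-row integer matrix from a vector `r ∈ ℤ^k`. -/
def rowMat {k : ℕ} (r : Fin k → ℤ) : Matrix (Fin 1) (Fin k) ℤ :=
  Matrix.of fun _ j => r j

/-- The set `ℳ(F)` of Mahler measures of all the nonzero `F_A`. -/
def Mset {k : ℕ} (F : LPoly k) : Set ℝ :=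
  { x | ∃ (l : ℕ) (A : Matrix (Fin l) (Fin k) ℤ), substM A F ≠ 0 ∧ mm (substM A F) = x }

/-- The set `ℳ₁(F)` of Mahler measures of the nonzero one-variable substitutions `F_r`. -/
def M1set {k : ℕ} (F : LPoly k) : Set ℝ :=
  { x | ∃ r : Fin k → ℤ, substM (rowMat r) F ≠ 0 ∧ mm (substM (rowMat r) F) = x }

open Polynomial in
lemma log_coeff_zero_le (P : ℂ[X]) (h : P.coeff 0 ≠ 0) :
    Real.log ‖P.coeff 0‖ ≤ P.logMahlerMeasure := by
  rw [Polynomial.logMahlerMeasure_eq_log_MahlerMeasure]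
  apply Real.log_le_log (norm_pos_iff.2 h)
  simpa using Polynomial.norm_coeff_le_choose_mul_mahlerMeasure 0 P

open Polynomial in
lemma lintegral_poly_le (P : ℂ[X]) (h : P.coeff 0 ≠ 0) (M : ℝ)
    (hM : ∀ θ : ℝ, Real.log ‖P.eval (circleMap 0 1 θ)‖ ≤ M) :
    ∫⁻ θ in Set.Ioc 0 (2 * Real.pi), ENNReal.ofReal (M - Real.log ‖P.eval (circleMap 0 1 θ)‖)
      ≤ ENNReal.ofReal (2 * Real.pi * (M - Real.log ‖P.coeff 0‖)) := by
  have hpi := Real.two_pi_pos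
  have hint := P.intervalIntegrable_mahlerMeasure
  have hint2 := (intervalIntegrable_iff_integrableOn_Ioc_of_le hpi.le).1 hint
  rw [← ofReal_integral_eq_lintegral_ofReal]
  · apply ENNReal.ofReal_le_ofReal
    rw [integral_sub (by simp) hint2]
    have h1 := log_coeff_zero_le P h
    rw [Polynomial.logMahlerMeasure_def, Real.circleAverage_def,
      intervalIntegral.integral_of_le hpi.le, smul_eq_mul] at h1
    have h2 := mul_le_mul_of_nonneg_left h1 hpi.le
    rw [mul_inv_cancel_left₀ hpi.ne'] at h2
    simp only [integral_const, MeasurableSet.univ, measureReal_restrict_apply, Set.univ_inter,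
      Real.volume_real_Ioc_of_le hpi.le, smul_eq_mul]
    linarith
  · exact (integrable_const M).sub hint2
  · exact Filter.Eventually.of_forall fun θ => sub_nonneg.2 (hM θ)

/-- The Laurent polynomial as a function on the additive torus. -/
def torFun {k : ℕ} (F : LPoly k) (x : Fin k → UnitAddCircle) : ℂ :=
  ∑ e ∈ F.support, F e * UnitAddTorus.mFourier e x

lemma evalT_eq {k : ℕ} (F : LPoly k) (t : Fin k → ℝ) :
    evalT F (torusPt t) = torFun F (fun i => (t i : UnitAddCircle)) := by
  unfold evalT torFun torusPt
  refine Finset.sum_congr rfl fun e _ => ?_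
  congr 1
  simp only [UnitAddTorus.mFourier, ContinuousMap.coe_mk]
  refine Finset.prod_congr rfl fun i _ => ?_
  rw [fourier_coe_apply, ← Complex.exp_int_mul]
  congr 1
  push_cast
  ring

lemma continuous_torFun {k : ℕ} (F : LPoly k) : Continuous (torFun F) := by
  unfold torFun
  fun_prop

lemma measPres {k : ℕ} : MeasurePreserving
    (fun (t : Fin k → ℝ) (i : Fin k) => (t i : UnitAddCircle))
    (volume.restrict (Set.Icc (0 : Fin k → ℝ) 1)) volume := by
  have h : (volume.restrict (Set.Icc (0 : Fin k → ℝ) 1)) =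
      Measure.pi (fun _ : Fin k => (volume : Measure ℝ).restrict (Set.Ioc 0 (0 + 1))) := by
    rw [← Set.pi_univ_Icc, volume_pi, Measure.restrict_pi_pi]
    congr 1
    funext i
    simp [restrict_Ioc_eq_restrict_Icc]
  rw [h]
  exact measurePreserving_pi _ _ (fun i => UnitAddCircle.measurePreserving_mk 0)

lemma norm_mFourier_apply {k : ℕ} (e : Fin k → ℤ) (x : Fin k → UnitAddCircle) :
    ‖UnitAddTorus.mFourier e x‖ = 1 := by
  simp only [UnitAddTorus.mFourier, fourier_apply, ContinuousMap.coe_mk, norm_prod,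
    Circle.norm_coe, Finset.prod_const_one]

lemma mFourier_add_arg {k : ℕ} (e : Fin k → ℤ) (x y : Fin k → UnitAddCircle) :
    UnitAddTorus.mFourier e (x + y) = UnitAddTorus.mFourier e x * UnitAddTorus.mFourier e y := by
  simp only [UnitAddTorus.mFourier, ContinuousMap.coe_mk, ← Finset.prod_mul_distrib]
  refine Finset.prod_congr rfl fun i _ => ?_
  simp [fourier_apply, smul_add, AddCircle.toCircle_add]

/-- the one-parameter subgroup with direction `r` -/
def lineT {k : ℕ} (r : Fin k → ℤ) (θ : ℝ) : Fin k → UnitAddCircle :=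
  fun i => ((r i * (θ / (2 * Real.pi)) : ℝ) : UnitAddCircle)

lemma continuous_lineT {k : ℕ} (r : Fin k → ℤ) : Continuous (lineT r) := by
  unfold lineT
  refine continuous_pi fun i => ?_
  exact (AddCircle.continuous_mk' (1 : ℝ)).comp (by fun_prop)

lemma mFourier_line {k : ℕ} (e r : Fin k → ℤ) (θ : ℝ) :
    UnitAddTorus.mFourier e (lineT r θ) = (circleMap 0 1 θ) ^ (∑ i, r i * e i) := by
  have h0 : circleMap 0 1 θ ≠ 0 := circleMap_ne_center one_ne_zero
  have hpi : (Real.pi : ℂ) ≠ 0 := by exact_mod_cast Real.pi_ne_zero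
  have h1 : circleMap 0 1 θ = Complex.exp (θ * Complex.I) := by simp [circleMap]
  rw [h1, ← Complex.exp_int_mul]
  simp only [UnitAddTorus.mFourier, ContinuousMap.coe_mk, lineT, fourier_coe_apply]
  rw [← Complex.exp_sum]
  congr 1
  push_cast
  rw [Finset.sum_mul]
  refine Finset.sum_congr rfl fun i _ => ?_
  field_simp

lemma log_torFun_le {k : ℕ} (F : LPoly k) (x : Fin k → UnitAddCircle) :
    Real.log ‖torFun F x‖ ≤ Real.log (1 + ∑ e ∈ F.support, ‖F e‖) := by
  have hs : 0 ≤ ∑ e ∈ F.support, ‖F e‖ := Finset.sum_nonneg fun _ _ => norm_nonneg _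
  have hle : ‖torFun F x‖ ≤ ∑ e ∈ F.support, ‖F e‖ := by
    refine (norm_sum_le _ _).trans (Finset.sum_le_sum fun e _ => ?_)
    rw [norm_mul, norm_mFourier_apply, mul_one]
  by_cases h : torFun F x = 0
  · simp only [h, norm_zero, Real.log_zero]
    exact Real.log_nonneg (by linarith)
  · exact Real.log_le_log (norm_pos_iff.2 h) (by linarith)

open Polynomial in
lemma exists_poly {k : ℕ} (F : LPoly k) (e₀ : Fin k → ℤ) (he₀ : e₀ ∈ F.support)
    (r : Fin k → ℤ) (hr : ∀ e ∈ F.support, e ≠ e₀ → ∑ i, r i * e₀ i < ∑ i, r i * e i)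
    (x : Fin k → UnitAddCircle) :
    ∃ P : ℂ[X], ‖P.coeff 0‖ = ‖F e₀‖ ∧
      ∀ θ : ℝ, ‖torFun F (x + lineT r θ)‖ = ‖P.eval (circleMap 0 1 θ)‖ := by
  refine ⟨∑ e ∈ F.support, monomial (∑ i, r i * e i - ∑ i, r i * e₀ i).toNat
    (F e * UnitAddTorus.mFourier e x), ?_, ?_⟩
  · rw [finsetSum_coeff, Finset.sum_eq_single e₀]
    · simp [norm_mFourier_apply]
    · intro e he hne
      have := hr e he hne
      rw [coeff_monomial, if_neg (by omega)]
    · exact fun h => absurd he₀ h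
  · intro θ
    have h0 : circleMap 0 1 θ ≠ 0 := circleMap_ne_center one_ne_zero
    have hn : ‖circleMap 0 1 θ‖ = 1 := by simp
    have : torFun F (x + lineT r θ) = (circleMap 0 1 θ) ^ (∑ i, r i * e₀ i) *
        (∑ e ∈ F.support, monomial (∑ i, r i * e i - ∑ i, r i * e₀ i).toNat
          (F e * UnitAddTorus.mFourier e x)).eval (circleMap 0 1 θ) := by
      rw [eval_finsetSum, Finset.mul_sum, torFun]
      refine Finset.sum_congr rfl fun e he => ?_
      rw [mFourier_add_arg, mFourier_line, eval_monomial, ← zpow_natCast]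
      have hnn : 0 ≤ ∑ i, r i * e i - ∑ i, r i * e₀ i := by
        by_cases hne : e = e₀
        · simp [hne]
        · exact (sub_pos.2 (hr e he hne)).le
      rw [Int.toNat_of_nonneg hnn, zpow_sub₀ h0]
      have := zpow_ne_zero (∑ i, r i * e₀ i) h0
      field_simp
    rw [this, norm_mul, norm_zpow, hn, one_zpow, one_mul]

lemma exists_dir {k : ℕ} (S : Finset (Fin k → ℤ)) (e₀ : Fin k → ℤ)
    (hext : (fun i => (e₀ i : ℝ)) ∈ Set.extremePoints ℝ
      (convexHull ℝ ((fun (e : Fin k → ℤ) (i : Fin k) => (e i : ℝ)) '' (S : Set (Fin k → ℤ))))) :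
    ∃ r : Fin k → ℤ, ∀ e ∈ S, e ≠ e₀ → ∑ i, r i * e₀ i < ∑ i, r i * e i := by
  classical
  set c : (Fin k → ℤ) → (Fin k → ℝ) := fun e i => (e i : ℝ) with hc
  have hinj : Function.Injective c := by
    intro a b hab
    funext i
    have := congrFun hab i
    simpa [hc] using this
  have h1 := ((convex_convexHull ℝ _).mem_extremePoints_iff_mem_sdiff_convexHull_sdiff.1 hext).2
  have h2 : c e₀ ∉ convexHull ℝ (c '' (S.erase e₀ : Finset (Fin k → ℤ))) := by
    intro h
    apply h1
    refine convexHull_mono ?_ h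
    rintro _ ⟨e, he, rfl⟩
    have he' := Finset.mem_erase.1 (Finset.mem_coe.1 he)
    refine ⟨subset_convexHull ℝ _ ⟨e, he'.2, rfl⟩, ?_⟩
    intro h
    exact he'.1 (hinj h)
  have hcl : IsClosed (convexHull ℝ (c '' (S.erase e₀ : Finset (Fin k → ℤ)))) :=
    (((Finset.finite_toSet _).image c).isCompact_convexHull (𝕜 := ℝ)).isClosed
  obtain ⟨f, u, hfu, hf⟩ := geometric_hahn_banach_point_closed (convex_convexHull ℝ _) hcl h2
  -- vector of the functional
  have hfv : ∀ v : Fin k → ℝ, f v = ∑ i, f (Pi.single i 1) * v i := by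
    intro v
    conv_lhs => rw [pi_eq_sum_univ' v]
    rw [map_sum]
    refine Finset.sum_congr rfl fun i _ => ?_
    rw [map_smul, smul_eq_mul, mul_comm]
  let U : Set (Fin k → ℝ) := ⋂ e ∈ S.erase e₀, {a | 0 < ∑ i, a i * ((e i : ℝ) - e₀ i)}
  have hU : IsOpen U := by
    apply isOpen_biInter_finset
    intro e _
    exact isOpen_lt continuous_const (by fun_prop)
  have hUne : U.Nonempty := by
    refine ⟨fun i => f (Pi.single i 1), ?_⟩
    simp only [U, Set.mem_iInter, Set.mem_ofPred_eq]
    intro e he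
    have h3 := hf (c e) (subset_convexHull ℝ _ ⟨e, he, rfl⟩)
    have h4 := hfu.trans h3
    rw [hfv, hfv (c e)] at h4
    simp only [mul_sub, Finset.sum_sub_distrib]
    exact sub_pos.2 h4
  have hd : DenseRange (fun (q : Fin k → ℚ) (i : Fin k) => (q i : ℝ)) :=
    DenseRange.piMap (fun _ => Rat.denseRange_cast)
  obtain ⟨q, hq⟩ := hd.exists_mem_open hU hUne
  simp only [U, Set.mem_iInter, Set.mem_ofPred_eq] at hq
  obtain ⟨N, hN⟩ : ∃ N : ℕ, N = ∏ i, (q i).den := ⟨_, rfl⟩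
  have hNpos : 0 < N := hN ▸ Finset.prod_pos fun i _ => (q i).den_pos
  have hz : ∀ i, ∃ z : ℤ, (z : ℚ) = N * q i := by
    intro i
    obtain ⟨m, hm⟩ : (q i).den ∣ N := hN ▸ Finset.dvd_prod_of_mem _ (Finset.mem_univ i)
    refine ⟨m * (q i).num, ?_⟩
    rw [hm]
    push_cast
    have := Rat.mul_den_eq_num (q i)
    rw [← this]
    ring
  choose z hz using hz
  refine ⟨z, fun e he hne => ?_⟩
  have h5 := hq e (Finset.mem_erase.2 ⟨hne, he⟩)
  have h6 : (0 : ℝ) < ∑ i, (z i : ℝ) * ((e i : ℝ) - e₀ i) := by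
    have : ∑ i, (z i : ℝ) * ((e i : ℝ) - e₀ i) = N * ∑ i, (q i : ℝ) * ((e i : ℝ) - e₀ i) := by
      rw [Finset.mul_sum]
      refine Finset.sum_congr rfl fun i _ => ?_
      have h7 : (z i : ℝ) = N * q i := by exact_mod_cast congrArg (fun a : ℚ => (a : ℝ)) (hz i)
      rw [h7]
      ring
    rw [this]
    positivity
  have h8 : 0 < ∑ i, z i * (e i - e₀ i) := by exact_mod_cast h6
  simp only [mul_sub, Finset.sum_sub_distrib] at h8
  linarith

lemma log_coeff_le_mm_aux {k : ℕ} (F : LPoly k) (e₀ : Fin k → ℤ)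
    (he₀ : e₀ ∈ F.support)
    (hext : (fun i => (e₀ i : ℝ)) ∈ Set.extremePoints ℝ
      (convexHull ℝ ((fun (e : Fin k → ℤ) (i : Fin k) => (e i : ℝ)) ''
        (F.support : Set (Fin k → ℤ))))) :
    Real.log ‖F e₀‖ ≤ mm F := by
  obtain ⟨r, hr⟩ := exists_dir F.support e₀ hext
  have hpi := Real.two_pi_pos
  have hF0 : F e₀ ≠ 0 := Finsupp.mem_support_iff.1 he₀
  obtain ⟨M, hM⟩ : ∃ M, M = Real.log (1 + ∑ e ∈ F.support, ‖F e‖) := ⟨_, rfl⟩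
  have hMle : ∀ x, Real.log ‖torFun F x‖ ≤ M := fun x => hM ▸ log_torFun_le F x
  have hMF : Real.log ‖F e₀‖ ≤ M := by
    rw [hM]
    apply Real.log_le_log (norm_pos_iff.2 hF0)
    have := Finset.single_le_sum (f := fun e => ‖F e‖) (fun _ _ => norm_nonneg _) he₀
    linarith
  have hmeas : Measurable fun x => Real.log ‖torFun F x‖ :=
    Real.measurable_log.comp (continuous_torFun F).norm.measurable
  have hgm : Measurable fun x => ENNReal.ofReal (M - Real.log ‖torFun F x‖) :=
    (measurable_const.sub hmeas).ennreal_ofReal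
  have : IsProbabilityMeasure (volume : Measure (Fin k → UnitAddCircle)) := by
    constructor
    rw [volume_pi, Measure.pi_univ]
    simp
  have hmain : ∫⁻ x : Fin k → UnitAddCircle, ENNReal.ofReal (M - Real.log ‖torFun F x‖)
      ≤ ENNReal.ofReal (M - Real.log ‖F e₀‖) := by
    have hA : ∀ θ : ℝ, ∫⁻ x : Fin k → UnitAddCircle,
        ENNReal.ofReal (M - Real.log ‖torFun F (x + lineT r θ)‖) =
        ∫⁻ x : Fin k → UnitAddCircle, ENNReal.ofReal (M - Real.log ‖torFun F x‖) := fun θ =>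
      lintegral_add_right_eq_self
        (fun x => ENNReal.ofReal (M - Real.log ‖torFun F x‖)) (lineT r θ)
    have hB : ∫⁻ θ in Set.Ioc 0 (2 * Real.pi), ∫⁻ x : Fin k → UnitAddCircle,
        ENNReal.ofReal (M - Real.log ‖torFun F (x + lineT r θ)‖) =
        ENNReal.ofReal (2 * Real.pi) *
        ∫⁻ x : Fin k → UnitAddCircle, ENNReal.ofReal (M - Real.log ‖torFun F x‖) := by
      simp_rw [hA]
      rw [setLIntegral_const, mul_comm, Real.volume_Ioc, sub_zero]
    rw [lintegral_lintegral_swap] at hB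
    · have hC : ENNReal.ofReal (2 * Real.pi) *
          ∫⁻ x : Fin k → UnitAddCircle, ENNReal.ofReal (M - Real.log ‖torFun F x‖) ≤
          ENNReal.ofReal (2 * Real.pi) * ENNReal.ofReal (M - Real.log ‖F e₀‖) := by
        rw [← hB, ← ENNReal.ofReal_mul hpi.le]
        calc _ ≤ ∫⁻ _ : Fin k → UnitAddCircle,
              ENNReal.ofReal (2 * Real.pi * (M - Real.log ‖F e₀‖)) := by
              refine lintegral_mono fun x => ?_
              obtain ⟨P, hP0, hP⟩ := exists_poly F e₀ he₀ r hr x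
              have := lintegral_poly_le P (by rw [← norm_pos_iff, hP0]; exact norm_pos_iff.2 hF0) M
                (fun θ => by rw [← hP]; exact hMle _)
              simpa only [hP, hP0] using this
          _ = _ := by simp
      exact (ENNReal.mul_le_mul_iff_right (by simpa using hpi) ENNReal.ofReal_ne_top).1 hC
    · apply Measurable.aemeasurable
      exact hgm.comp (continuous_snd.add ((continuous_lineT r).comp continuous_fst)).measurable
  have hint : Integrable (fun x : Fin k → UnitAddCircle => M - Real.log ‖torFun F x‖) := by
    refine ⟨(measurable_const.sub hmeas).aestronglyMeasurable, ?_⟩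
    rw [hasFiniteIntegral_iff_ofReal
      (Filter.Eventually.of_forall fun x => sub_nonneg.2 (hMle x))]
    exact hmain.trans_lt ENNReal.ofReal_lt_top
  have hint2 : Integrable (fun x : Fin k → UnitAddCircle => Real.log ‖torFun F x‖) := by
    have := (integrable_const M).sub hint
    simpa [Pi.sub_def] using this
  have hmm : mm F = ∫ x : Fin k → UnitAddCircle, Real.log ‖torFun F x‖ := by
    unfold mm
    simp_rw [evalT_eq]
    rw [← measPres.map_eq, integral_map measPres.measurable.aemeasurable
      hmeas.aestronglyMeasurable]
  rw [← ofReal_integral_eq_lintegral_ofReal hint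
      (Filter.Eventually.of_forall fun x => sub_nonneg.2 (hMle x)),
    ENNReal.ofReal_le_ofReal_iff (sub_nonneg.2 hMF),
    integral_sub (integrable_const M) hint2] at hmain
  rw [hmm]
  simp only [integral_const, probReal_univ, one_smul] at hmain
  linarith

/-- If `j₀` is an extreme point of the exponent polytope of a nonzero Laurent
polynomial `F` (the convex hull in `ℝ^k` of the exponents of nonzero coefficients),
then `m(F) ≥ log|c(j₀)|`.  In particular, a nonzero Laurent polynomial with
integer coefficients has nonnegative logarithmic Mahler measure. -/
theorem log_coeff_le_mm {k : ℕ} (F : LPoly k) (hF : F ≠ 0) (e₀ : Fin k → ℤ)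
    (he₀ : e₀ ∈ F.support)
    (hext : (fun i => (e₀ i : ℝ)) ∈ Set.extremePoints ℝ
      (convexHull ℝ ((fun (e : Fin k → ℤ) (i : Fin k) => (e i : ℝ)) ''
        (F.support : Set (Fin k → ℤ))))) :
    Real.log ‖F e₀‖ ≤ mm F ∧
    (∀ G : LPoly k, G ≠ 0 → (∀ e, ∃ n : ℤ, G e = (n : ℂ)) → 0 ≤ mm G) := by
  refine ⟨log_coeff_le_mm_aux F e₀ he₀ hext, fun G hG hint => ?_⟩
  have hcomp : IsCompact (convexHull ℝ ((fun (e : Fin k → ℤ) (i : Fin k) => (e i : ℝ)) ''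
        (G.support : Set (Fin k → ℤ)))) :=
    ((Finset.finite_toSet _).image _).isCompact_convexHull (𝕜 := ℝ)
  have hne : (convexHull ℝ ((fun (e : Fin k → ℤ) (i : Fin k) => (e i : ℝ)) ''
        (G.support : Set (Fin k → ℤ)))).Nonempty := by
    rw [convexHull_nonempty_iff]
    exact (Finset.coe_nonempty.2 (Finsupp.support_nonempty_iff.2 hG)).image _
  obtain ⟨v, hv⟩ := hcomp.extremePoints_nonempty hne
  obtain ⟨e, he, rfl⟩ := extremePoints_convexHull_subset hv
  refine le_trans ?_ (log_coeff_le_mm_aux G e he hv)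
  obtain ⟨n, hn⟩ := hint e
  have h0 : G e ≠ 0 := Finsupp.mem_support_iff.1 he
  apply Real.log_nonneg
  rw [hn] at h0 ⊢
  rw [Complex.norm_intCast]
  have : n ≠ 0 := by exact_mod_cast h0
  exact_mod_cast Int.one_le_abs this
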